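/- Let φ be a 3-CNF formula in which every clause has exactly three literals whose variables are pairwise distinct, and let G_φ and k_φ = 16|C(φ)| be as defined in the context. Then φ is satisfiable if and only if there exists a set S ⊆ E(G_φ) with |S| ≤ k_φ such that G_φ − S contains no induced path on four vertices (no induced P4). -/

import Mathlib

open SimpleGraph

variable {Var : Type} [DecidableEq Var]

/-- `p_x`: the number of clauses containing the variable `x`.  Clauses are indexed by
`Fin m` and `lit c a` is the `a`-th literal of clause `c` (a variable with a Boolean which
is `true` for a non-negated occurrence). -/
def numOcc {m : ℕ} (lit : Fin m → Fin 3 → Var × Bool) (x : Var) : ℕ :=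
  (Finset.univ.filter (fun c : Fin m => ∃ a : Fin 3, (lit c a).1 = x)).card

/-- The (0-based) occurrence index of clause `c` among the clauses containing `x`:
the number of clauses before `c` that contain `x`. -/
def occIdx {m : ℕ} (lit : Fin m → Fin 3 → Var × Bool) (x : Var) (c : Fin m) : ℕ :=
  (Finset.univ.filter (fun c' : Fin m => c' < c ∧ ∃ a : Fin 3, (lit c' a).1 = x)).card

/-- The graph `G_φ` of the reduction from 3-SAT to `P₄`-free edge deletion, with
`k' = k_φ + 3 = 16 m + 3`.  Variable gadget for `x`: for each `i : Fin p_x` a stack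
`s^x_{i,j}` (`Sum.inl j`, `j : Fin (16 m + 3)`), two spikes `t^x_{i,1}, t^x_{i,2}`
(`Sum.inr (Sum.inl e)`, `e : Fin 2`) and five base vertices `b^x_{i,1}, …, b^x_{i,5}`
(`Sum.inr (Sum.inr b)`, `b : Fin 5`).  Clause gadget for `c`: the vertex `u^c`
(`Sum.inl ()`) and vertices `u^r_2, u^r_3` for the three literal positions
(`Sum.inr (a, e)`, `a : Fin 3`, `e : Fin 2` with `e = 0` for `u^r_2`, `e = 1` for
`u^r_3`). -/
def satP4DelGraph {m : ℕ} (lit : Fin m → Fin 3 → Var × Bool) :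
    SimpleGraph ((Σ _x : Var, Fin (numOcc lit _x) × (Fin (16 * m + 3) ⊕ Fin 2 ⊕ Fin 5)) ⊕
      (Fin m × (Unit ⊕ Fin 3 × Fin 2))) :=
  SimpleGraph.fromRel (fun uu ww =>
    match uu, ww with
    | Sum.inl ⟨x, (i, z)⟩, Sum.inl ⟨y, (i', z')⟩ =>
        x = y ∧
        ( ((i' : ℕ) = (i : ℕ) ∧
            (match z, z' with
             | Sum.inl _, Sum.inr (Sum.inr b) => (b : ℕ) = 0
             | Sum.inr (Sum.inr b), Sum.inr (Sum.inr b') =>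
                 (((b : ℕ), (b' : ℕ)) ∈
                   ({(0, 1), (0, 2), (1, 2), (2, 3), (2, 4), (3, 4)} : Set (ℕ × ℕ)))
             | Sum.inr (Sum.inr b), Sum.inr (Sum.inl e) =>
                 ((b : ℕ) = 1 ∧ (e : ℕ) = 0) ∨ ((b : ℕ) = 3 ∧ (e : ℕ) = 1)
             | _, _ => False)) ∨
          ((i' : ℕ) = ((i : ℕ) + 1) % numOcc lit x ∧
            (match z, z' with
             | Sum.inr (Sum.inr b), Sum.inl _ => (b : ℕ) = 4
             | Sum.inr (Sum.inr b), Sum.inr (Sum.inr b') => (b : ℕ) = 4 ∧ (b' : ℕ) = 0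
             | _, _ => False)))
    | Sum.inl ⟨x, (i, z)⟩, Sum.inr (c, Sum.inr (a, _e)) =>
        ∃ b : Bool, lit c a = (x, b) ∧ (i : ℕ) = occIdx lit x c ∧
          z = Sum.inr (Sum.inl (if b then (0 : Fin 2) else 1))
    | Sum.inl _, Sum.inr (_, Sum.inl _) => False
    | Sum.inr (c, z), Sum.inr (d, z') =>
        c = d ∧
        (match z, z' with
         | Sum.inl _, Sum.inr _ => True
         | Sum.inr (a, e), Sum.inr (a', e') => a = a' ∧ (e : ℕ) = 0 ∧ (e' : ℕ) = 1
         | _, _ => False)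
    | Sum.inr _, Sum.inl _ => False)

/-- The vertices of the reduction graph, where `P` is the type of variable occurrences.  The spike
`t_1` is `spike p true` and `t_2` is `spike p false`. -/
inductive GadgetVertex (P : Type) (m K : ℕ) : Type
  | stack (p : P) (j : Fin K)
  | spike (p : P) (e : Bool)
  | base (p : P) (b : Fin 5)
  | centre (c : Fin m)
  | wing (c : Fin m) (a : Fin 3) (e : Bool)

/-- The edges inside the base of a variable gadget. -/
def BaseArc (b b' : Fin 5) : Prop :=
  (b, b') ∈ ([(0, 1), (0, 2), (1, 2), (2, 3), (2, 4), (3, 4)] : List (Fin 5 × Fin 5))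

instance (b b' : Fin 5) : Decidable (BaseArc b b') := by unfold BaseArc; infer_instance

/-- The base vertex to which a spike is attached. -/
def spikeBase (e : Bool) : Fin 5 := if e then 1 else 3

/-- The base vertices of the triangle that survives when the variable has truth value `x`. -/
def InTriangle (x : Bool) (b : Fin 5) : Prop := if x then b ≤ 2 else 2 ≤ b

section Gadget

open GadgetVertex

variable {P : Type} {m K : ℕ}

/-- The edges of the reduction graph, each with a chosen orientation. -/
inductive GadgetArc (nxt : P → P) (occ : Fin m → Fin 3 → P) (pol : Fin m → Fin 3 → Bool) :
    GadgetVertex P m K → GadgetVertex P m K → Prop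
  | stackBase (p j b) (hb : b = 0) : GadgetArc nxt occ pol (stack p j) (base p b)
  | baseStack (p q b j) (hb : b = 4) (hq : q = nxt p) : GadgetArc nxt occ pol (base p b) (stack q j)
  | shortcut (p q b b') (hb : b = 4) (hb' : b' = 0) (hq : q = nxt p) :
      GadgetArc nxt occ pol (base p b) (base q b')
  | inBase (p b b') (h : BaseArc b b') : GadgetArc nxt occ pol (base p b) (base p b')
  | baseSpike (p b e) (hb : b = spikeBase e) : GadgetArc nxt occ pol (base p b) (spike p e)
  | link (p f c a e) (hp : p = occ c a) (hf : f = pol c a) :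
      GadgetArc nxt occ pol (spike p f) (wing c a e)
  | centreWing (c a e) : GadgetArc nxt occ pol (centre c) (wing c a e)
  | wingWing (c a e e') (he : e = false) (he' : e' = true) :
      GadgetArc nxt occ pol (wing c a e) (wing c a e')

/-- The edges that survive the deletion prescribed by the truth values `β` and by a choice `sel` of
a literal in each clause. -/
inductive KeptArc (nxt : P → P) (occ : Fin m → Fin 3 → P) (pol : Fin m → Fin 3 → Bool)
    (β : P → Bool) (sel : Fin m → Fin 3) : GadgetVertex P m K → GadgetVertex P m K → Prop
  | stackBase (p j b) (hb : b = 0) : KeptArc nxt occ pol β sel (stack p j) (base p b)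
  | baseStack (p q b j) (hb : b = 4) (hq : q = nxt p) :
      KeptArc nxt occ pol β sel (base p b) (stack q j)
  | shortcut (p q b b') (hb : b = 4) (hb' : b' = 0) (hq : q = nxt p) :
      KeptArc nxt occ pol β sel (base p b) (base q b')
  | inBase (p b b') (h : BaseArc b b') (hβ : if β p then b' ≤ 2 else 2 ≤ b) :
      KeptArc nxt occ pol β sel (base p b) (base p b')
  | baseSpike (p b e) (hb : b = spikeBase e) (hβ : e = !β p) :
      KeptArc nxt occ pol β sel (base p b) (spike p e)
  | link (p f c a e) (hp : p = occ c a) (hf : f = pol c a) :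
      KeptArc nxt occ pol β sel (spike p f) (wing c a e)
  | centreWing (c a e) (ha : a = sel c) : KeptArc nxt occ pol β sel (centre c) (wing c a e)
  | wingWing (c a e e') (he : e = false) (he' : e' = true) :
      KeptArc nxt occ pol β sel (wing c a e) (wing c a e')

variable (nxt : P → P) (occ : Fin m → Fin 3 → P) (pol : Fin m → Fin 3 → Bool)

/-- The reduction graph on `GadgetVertex`. -/
def gadgetGraph (K : ℕ) : SimpleGraph (GadgetVertex P m K) where
  Adj v w := GadgetArc nxt occ pol v w ∨ GadgetArc nxt occ pol w v
  symm := ⟨fun _ _ h => h.symm⟩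
  loopless := ⟨fun v h => by
    rcases h with h | h <;> cases h <;> simp_all [BaseArc] <;> omega⟩

/-- The graph of surviving edges. -/
def keptGraph (β : P → Bool) (sel : Fin m → Fin 3) (K : ℕ) : SimpleGraph (GadgetVertex P m K) where
  Adj v w := KeptArc nxt occ pol β sel v w ∨ KeptArc nxt occ pol β sel w v
  symm := ⟨fun _ _ h => h.symm⟩
  loopless := ⟨fun v h => by
    rcases h with h | h <;> cases h <;> simp_all [BaseArc] <;> omega⟩

end Gadget

section InducedPath

variable {V : Type*} {G : SimpleGraph V}

theorem isEmpty_pathGraph_four_embedding_of_nested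
    (h : ∀ v w, G.Adj v w → (∀ a, G.Adj a v → a ≠ w → G.Adj a w) ∨
      (∀ a, G.Adj a w → a ≠ v → G.Adj a v)) :
    IsEmpty (SimpleGraph.pathGraph 4 ↪g G) := by
  refine ⟨fun f => ?_⟩
  have hadj : ∀ i j, G.Adj (f i) (f j) ↔ (SimpleGraph.pathGraph 4).Adj i j :=
    fun i j => f.map_rel_iff
  rcases h (f 1) (f 2) (by simp [hadj, SimpleGraph.pathGraph_adj]) with h | h
  · have := h (f 0) (by simp [hadj, SimpleGraph.pathGraph_adj]) (by simp)
    simp [hadj, SimpleGraph.pathGraph_adj] at this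
  · have := h (f 3) (by simp [hadj, SimpleGraph.pathGraph_adj]) (by simp)
    simp [hadj, SimpleGraph.pathGraph_adj] at this

theorem no_induced_path_of_isEmpty (h : IsEmpty (SimpleGraph.pathGraph 4 ↪g G)) {a b c d : V}
    (hab : G.Adj a b) (hbc : G.Adj b c) (hcd : G.Adj c d) (hac : ¬ G.Adj a c) (hbd : ¬ G.Adj b d)
    (had : ¬ G.Adj a d) : False := by
  have e1 : a ≠ c := by rintro rfl; exact had hcd
  have e2 : a ≠ d := by rintro rfl; exact hbd hab.symm
  have e3 : b ≠ d := by rintro rfl; exact had hab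
  have hinj : Function.Injective ![a, b, c, d] := by
    intro i j hij
    have := hab.ne; have := hbc.ne; have := hcd.ne
    fin_cases i <;> fin_cases j <;> simp_all
  have hadj : ∀ i j, G.Adj (![a, b, c, d] i) (![a, b, c, d] j) ↔
      (SimpleGraph.pathGraph 4).Adj i j := by
    intro i j
    have := hab.symm; have := hbc.symm; have := hcd.symm
    rw [G.adj_comm] at hac hbd had
    have hca := hac; have hdb := hbd; have hda := had
    rw [G.adj_comm] at hca hdb hda
    fin_cases i <;> fin_cases j <;> simp_all [SimpleGraph.pathGraph_adj]
  exact h.elim ⟨⟨_, hinj⟩, hadj _ _⟩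

/-- Deleting few edges so as to destroy all induced `P₄`s is invariant under isomorphism. -/
theorem exists_deleteEdges_of_iso {V' W : Type*} {A : SimpleGraph W} {G' : SimpleGraph V'}
    (f : G ≃g G') {k : ℕ}
    (h : ∃ S ⊆ G.edgeSet, S.ncard ≤ k ∧ IsEmpty (A ↪g G.deleteEdges S)) :
    ∃ S ⊆ G'.edgeSet, S.ncard ≤ k ∧ IsEmpty (A ↪g G'.deleteEdges S) := by
  obtain ⟨S, hS, hk, hE⟩ := h
  have hinj : Function.Injective (Sym2.map f) := Sym2.map.injective f.injective
  refine ⟨Sym2.map f '' S, ?_, ?_, ⟨fun g => hE.elim (g.trans ?_)⟩⟩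
  · rintro _ ⟨e, he, rfl⟩
    have := hS he
    induction e with
    | h v w => simpa [f.map_adj_iff] using this
  · rwa [Set.ncard_image_of_injective _ hinj]
  · refine ⟨f.symm.toEquiv.toEmbedding, fun {v w} => ?_⟩
    have : s(v, w) = Sym2.map f s(f.symm v, f.symm w) := by simp
    rw [SimpleGraph.deleteEdges_adj, SimpleGraph.deleteEdges_adj, this, hinj.mem_set_image]
    simp [f.symm.map_adj_iff]

end InducedPath

section Gadget

open GadgetVertex

variable {P : Type} {m K : ℕ} {nxt : P → P} {occ : Fin m → Fin 3 → P} {pol : Fin m → Fin 3 → Bool}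

theorem keptGraph_le_gadgetGraph (β : P → Bool) (sel : Fin m → Fin 3) :
    keptGraph nxt occ pol β sel K ≤ gadgetGraph nxt occ pol K := by
  have : ∀ v w : GadgetVertex P m K, KeptArc nxt occ pol β sel v w → GadgetArc nxt occ pol v w := by
    intro v w h
    cases h with
    | inBase p b b' h => exact .inBase _ _ _ h
    | _ => constructor <;> assumption
  exact fun v w h => h.imp (this _ _) (this _ _)

theorem keptGraph_adj_base {β : P → Bool} {sel : Fin m → Fin 3} {p : P} {b b' : Fin 5}
    (hb : InTriangle (β p) b) (hb' : InTriangle (β p) b') (hne : b ≠ b') :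
    (keptGraph nxt occ pol β sel K).Adj (base p b) (base p b') := by
  have key : (BaseArc b b' ∧ (if β p then b' ≤ 2 else 2 ≤ b)) ∨
      (BaseArc b' b ∧ (if β p then b ≤ 2 else 2 ≤ b')) := by
    unfold InTriangle at hb hb'
    generalize β p = x at *
    revert x b b'
    decide
  exact key.imp (fun h => .inBase _ _ _ h.1 h.2) (fun h => .inBase _ _ _ h.1 h.2)

theorem exists_of_keptGraph_adj_base {β : P → Bool} {sel : Fin m → Fin 3} {p : P} {b : Fin 5}
    {a : GadgetVertex P m K} (hb : if β p then b = 1 ∨ b = 2 else b = 2 ∨ b = 3)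
    (h : (keptGraph nxt occ pol β sel K).Adj a (base p b)) :
    ∃ b', a = base p b' ∧ InTriangle (β p) b' := by
  have h0 : b ≠ 0 := by rintro rfl; cases h : β p <;> simp [h] at hb
  have h4 : b ≠ 4 := by rintro rfl; cases h : β p <;> simp [h] at hb
  have key : ∀ (y : Bool) (x b : Fin 5), (BaseArc x b ∧ (if y then b ≤ 2 else 2 ≤ x)) ∨
      (BaseArc b x ∧ (if y then x ≤ 2 else 2 ≤ b)) →
      (if y then b = 1 ∨ b = 2 else b = 2 ∨ b = 3) → InTriangle y x := by
    unfold InTriangle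
    decide
  rcases h with h | h <;> cases h
  case inl.inBase x h h' => exact ⟨x, rfl, key _ _ _ (.inl ⟨h, h'⟩) hb⟩
  case inr.inBase x h h' => exact ⟨x, rfl, key _ _ _ (.inr ⟨h, h'⟩) hb⟩
  case inr.baseSpike e he hb' =>
    cases h : β p <;> rw [h] at he <;> subst he <;> simp_all [spikeBase]
  all_goals contradiction

/-- In the graph of surviving edges, the ends of every edge have nested closed neighbourhoods. -/
theorem keptGraph_nested (hnxt : Function.Injective nxt)
    (hocc : ∀ c a c' a', occ c a = occ c' a' → c = c' ∧ a = a') {β : P → Bool}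
    {sel : Fin m → Fin 3} (hβ : ∀ p, β (nxt p) = β p)
    (hsel : ∀ c, β (occ c (sel c)) = pol c (sel c)) {v w : GadgetVertex P m K}
    (h : KeptArc nxt occ pol β sel v w) :
    (∀ a, (keptGraph nxt occ pol β sel K).Adj a v → a ≠ w →
        (keptGraph nxt occ pol β sel K).Adj a w) ∨
      (∀ a, (keptGraph nxt occ pol β sel K).Adj a w → a ≠ v →
        (keptGraph nxt occ pol β sel K).Adj a v) := by
  cases h with
  | stackBase p j b hb =>
    left
    rintro a (h | h) hne <;> cases h
    · subst_vars
      exact Or.inl (.shortcut _ _ _ _ rfl rfl rfl)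
    · simp_all
  | baseStack p q b j hb hq =>
    right
    rintro a (h | h) hne <;> cases h
    · next p' b' hb' hq' =>
      have := hnxt (hq.symm.trans hq')
      simp_all
    · exact Or.inr (.shortcut _ _ _ _ hb (by assumption) hq)
  | shortcut p q b b' hb hb' hq =>
    have hpq : β q = β p := by rw [hq, hβ]
    subst hb hb'
    cases hp : β p
    · right
      rintro a (h | h) hne <;> cases h
      case inl.stackBase => exact Or.inr (.baseStack _ _ _ _ rfl hq)
      case inl.shortcut p' b' hb' hq' _ => exact absurd (hnxt (hq'.symm.trans hq)) (by simp_all)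
      case inr.baseSpike e _ he => cases e <;> simp [spikeBase] at he
      all_goals simp_all [BaseArc]
    · left
      rintro a (h | h) hne <;> cases h
      case inr.baseStack j hq' _ => exact Or.inl (hq.trans hq'.symm ▸ .stackBase _ _ _ rfl)
      case inr.baseSpike e _ he => cases e <;> simp [spikeBase] at he
      all_goals simp_all [BaseArc]
  | inBase p b b' h hb =>
    have key : ((if β p then b = 1 ∨ b = 2 else b = 2 ∨ b = 3) ∧ InTriangle (β p) b') ∨
        ((if β p then b' = 1 ∨ b' = 2 else b' = 2 ∨ b' = 3) ∧ InTriangle (β p) b) := by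
      unfold InTriangle
      generalize β p = x at *
      revert x b b'
      decide
    rcases key with ⟨hb, hb'⟩ | ⟨hb, hb'⟩
    · left
      intro a ha hne
      obtain ⟨x, rfl, hx⟩ := exists_of_keptGraph_adj_base hb ha
      exact keptGraph_adj_base hx hb' (by simpa using hne)
    · right
      intro a ha hne
      obtain ⟨x, rfl, hx⟩ := exists_of_keptGraph_adj_base hb ha
      exact keptGraph_adj_base hx hb' (by simpa using hne)
  | baseSpike p b e hb he =>
    left
    subst hb
    rintro a (h | h) hne <;> cases hp : β p <;> rw [hp] at he <;> subst he <;> cases h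
    case inr.false.baseSpike e _ hb => cases e <;> simp_all [spikeBase]
    case inr.true.baseSpike e _ hb => cases e <;> simp_all [spikeBase]
    case inl.false.inBase b hb h => revert b; simp [hp, BaseArc, spikeBase]
    case inl.true.inBase b hb h => revert b; simp [hp, BaseArc, spikeBase]
    case inr.false.inBase b hb h => revert b; simp [hp, BaseArc, spikeBase]
    case inr.true.inBase b hb h => revert b; simp [hp, BaseArc, spikeBase]
    all_goals simp_all [spikeBase]
  | link p f c a e hp hf =>
    by_cases ha : a = sel c
    · left
      rintro a' (h | h) hne <;> cases h
      · subst_vars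
        simp_all
      · next c' a' e' hp' hf' =>
        obtain ⟨rfl, rfl⟩ := hocc _ _ _ _ (hp.symm.trans hp')
        cases e <;> cases e'
        · simp at hne
        · exact Or.inr (.wingWing _ _ _ _ rfl rfl)
        · exact Or.inl (.wingWing _ _ _ _ rfl rfl)
        · simp at hne
    · right
      rintro a' (h | h) hne <;> cases h
      · simp_all
      · contradiction
      · exact Or.inr (.link _ _ _ _ _ hp hf)
      · exact Or.inr (.link _ _ _ _ _ hp hf)
  | centreWing c a e ha =>
    left
    rintro a' (h | h) hne <;> cases h
    next a' e' ha' =>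
    obtain rfl : a' = a := ha'.trans ha.symm
    cases e <;> cases e'
    · simp at hne
    · exact Or.inr (.wingWing _ _ _ _ rfl rfl)
    · exact Or.inl (.wingWing _ _ _ _ rfl rfl)
    · simp at hne
  | wingWing c a e e' he he' =>
    left
    rintro a' (h | h) hne <;> cases h
    · exact Or.inl (.link _ _ _ _ _ (by assumption) (by assumption))
    · exact Or.inl (.centreWing _ _ _ (by assumption))
    · simp_all
    · simp_all

theorem exists_deletion_of_assignment [Finite P] (hcard : Nat.card P = 3 * m)
    (hnxt : Function.Injective nxt)
    (hocc : ∀ c a c' a', occ c a = occ c' a' → c = c' ∧ a = a') {β : P → Bool}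
    {sel : Fin m → Fin 3} (hβ : ∀ p, β (nxt p) = β p)
    (hsel : ∀ c, β (occ c (sel c)) = pol c (sel c)) :
    ∃ S ⊆ (gadgetGraph nxt occ pol K).edgeSet, S.ncard ≤ 16 * m ∧
      IsEmpty (SimpleGraph.pathGraph 4 ↪g (gadgetGraph nxt occ pol K).deleteEdges S) := by
  refine ⟨(gadgetGraph nxt occ pol K).edgeSet \ (keptGraph nxt occ pol β sel K).edgeSet,
    Set.sdiff_subset, ?_, ?_⟩
  · let D : (P × Fin 4) ⊕ (Fin m × Fin 2 × Bool) → Sym2 (GadgetVertex P m K) := Sum.elim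
      (fun x => if β x.1 then
          ![s(base x.1 2, base x.1 3), s(base x.1 2, base x.1 4), s(base x.1 3, base x.1 4),
            s(base x.1 1, spike x.1 true)] x.2
        else ![s(base x.1 0, base x.1 1), s(base x.1 0, base x.1 2), s(base x.1 1, base x.1 2),
            s(base x.1 3, spike x.1 false)] x.2)
      (fun x => s(centre x.1, wing x.1 ((sel x.1).succAbove x.2.1) x.2.2))
    have hD : (gadgetGraph nxt occ pol K).edgeSet \ (keptGraph nxt occ pol β sel K).edgeSet ⊆
        Set.range D := by
      have key : ∀ v w : GadgetVertex P m K, GadgetArc nxt occ pol v w →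
          ¬ KeptArc nxt occ pol β sel v w → s(v, w) ∈ Set.range D := by
        intro v w h h'
        cases h with
        | inBase p b b' h =>
          have hb : ¬ if β p then b' ≤ 2 else 2 ≤ b := fun hb => h' (.inBase _ _ _ h hb)
          simp only [BaseArc, List.mem_cons, Prod.mk.injEq, List.not_mem_nil, or_false] at h
          cases hp : β p <;>
            rcases h with ⟨rfl, rfl⟩ | ⟨rfl, rfl⟩ | ⟨rfl, rfl⟩ | ⟨rfl, rfl⟩ | ⟨rfl, rfl⟩ | ⟨rfl, rfl⟩
          all_goals solve
            | (exfalso; revert hb; rw [hp]; decide)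
            | (refine ⟨.inl (p, 0), ?_⟩; simp [D, hp])
            | (refine ⟨.inl (p, 1), ?_⟩; simp [D, hp])
            | (refine ⟨.inl (p, 2), ?_⟩; simp [D, hp])
        | baseSpike p b e hb =>
          have he : e ≠ !β p := fun he => h' (.baseSpike _ _ _ hb he)
          refine ⟨.inl (p, 3), ?_⟩
          subst hb
          cases hp : β p <;> cases e <;> simp_all [D, spikeBase]
        | centreWing c a e =>
          have ha : a ≠ sel c := fun ha => h' (.centreWing _ _ _ ha)
          obtain ⟨k, rfl⟩ := Fin.exists_succAbove_eq ha
          exact ⟨.inr (c, k, e), rfl⟩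
        | _ => exact absurd (by constructor <;> assumption) h'
      rintro ⟨v, w⟩ ⟨h | h, h'⟩
      · exact key v w h fun hk => h' (.inl hk)
      · have := key w v h fun hk => h' (.inr hk)
        rwa [Sym2.eq_swap] at this
    refine (Set.ncard_le_ncard hD (Set.finite_range D)).trans ?_
    rw [← Set.image_univ]
    refine (Set.ncard_image_le Set.finite_univ).trans ?_
    rw [Set.ncard_univ, Nat.card_sum, Nat.card_prod, hcard]
    simp
    omega
  · rw [SimpleGraph.deleteEdges_sdiff_eq_of_le (keptGraph_le_gadgetGraph β sel)]
    apply isEmpty_pathGraph_four_embedding_of_nested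
    rintro v w (h | h)
    · exact keptGraph_nested hnxt hocc hβ hsel h
    · exact (keptGraph_nested hnxt hocc hβ hsel h).symm

instance [Finite P] : Finite (GadgetVertex P m K) := by
  refine Finite.of_surjective (Sum.elim (fun x => stack x.1 x.2) <| Sum.elim
    (fun x => spike x.1 x.2) <| Sum.elim (fun x => base x.1 x.2) <| Sum.elim centre
    (fun x => wing x.1 x.2.1 x.2.2) : (P × Fin K) ⊕ (P × Bool) ⊕ (P × Fin 5) ⊕ Fin m ⊕
      (Fin m × Fin 3 × Bool) → GadgetVertex P m K) ?_
  rintro (⟨p, j⟩ | ⟨p, e⟩ | ⟨p, b⟩ | c | ⟨c, a, e⟩)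
  · exact ⟨.inl (p, j), rfl⟩
  · exact ⟨.inr (.inl (p, e)), rfl⟩
  · exact ⟨.inr (.inr (.inl (p, b))), rfl⟩
  · exact ⟨.inr (.inr (.inr (.inl c))), rfl⟩
  · exact ⟨.inr (.inr (.inr (.inr (c, a, e)))), rfl⟩

/-- Four pairs of edges at a base; a small deletion set meets each pair in exactly one edge. -/
def basePair (p : P) (k : Fin 4) (e : Bool) : Sym2 (GadgetVertex P m K) :=
  if e then ![s(base p 1, spike p true), s(base p 2, base p 4), s(base p 2, base p 3),
    s(base p 3, spike p false)] k
  else ![s(base p 0, base p 1), s(base p 1, base p 2), s(base p 0, base p 2),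
    s(base p 3, base p 4)] k

variable (occ pol) in
/-- The edges joining a wing vertex to the centre and to its spike. -/
def wingPair (c : Fin m) (a : Fin 3) (e k : Bool) : Sym2 (GadgetVertex P m K) :=
  if k then s(spike (occ c a) (pol c a), wing c a e) else s(centre c, wing c a e)

variable (occ pol) in
theorem injective_basePair_wingPair : Function.Injective
    (Sum.elim (fun x => basePair x.1 x.2.1 x.2.2)
      (fun x => wingPair occ pol x.1 x.2.1 x.2.2.1 x.2.2.2) :
      (P × Fin 4 × Bool) ⊕ (Fin m × Fin 3 × Bool × Bool) → Sym2 (GadgetVertex P m K)) := by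
  rintro (⟨p, k, e⟩ | ⟨c, a, e, k⟩) (⟨p', k', e'⟩ | ⟨c', a', e', k'⟩) h
  · fin_cases k <;> fin_cases k' <;> cases e <;> cases e' <;> simp_all [basePair]
  · exfalso
    fin_cases k <;> cases k' <;> cases e <;> simp_all [basePair, wingPair]
  · exfalso
    fin_cases k' <;> cases k <;> cases e' <;> simp_all [basePair, wingPair]
  · cases k <;> cases k' <;> simp_all [wingPair]

theorem exists_stack_notMem [Finite P] {S : Set (Sym2 (GadgetVertex P m K))}
    (hS : S ⊆ (gadgetGraph nxt occ pol K).edgeSet) (hcard : S.ncard < K) (p : P) :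
    ∃ j, ∀ v, s(stack p j, v) ∉ S := by
  by_contra! h
  choose f hf using h
  have hinj : Function.Injective (fun j => (⟨s(stack p j, f j), hf j⟩ : S)) := by
    intro i j hij
    simp only [Subtype.mk.injEq, Sym2.eq_iff, stack.injEq, true_and] at hij
    rcases hij with h | ⟨h, h'⟩
    · exact h.1
    · have := hS (hf i)
      rw [h'] at this
      rcases this with h | h <;> cases h
  have := Nat.card_le_card_of_injective _ hinj
  rw [Nat.card_fin, Nat.card_coe_set_eq] at this
  omega

theorem deleteEdges_adj_of_notMem {V : Type*} {G : SimpleGraph V} {S : Set (Sym2 V)} {v w : V}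
    (h : G.Adj v w) (h' : s(v, w) ∉ S) : (G.deleteEdges S).Adj v w :=
  SimpleGraph.deleteEdges_adj.2 ⟨h, h'⟩

theorem not_adj_stack_base {p q : P} {j : Fin K} {b : Fin 5} (h0 : b ≠ 0) (h4 : b ≠ 4) :
    ¬ (gadgetGraph nxt occ pol K).Adj (stack p j) (base q b) := by
  rintro (h | h) <;> cases h <;> contradiction

theorem not_adj_stack_spike {p q : P} {j : Fin K} {e : Bool} :
    ¬ (gadgetGraph nxt occ pol K).Adj (stack p j) (spike q e) := by
  rintro (h | h) <;> cases h

theorem not_adj_base_spike {p q : P} {b : Fin 5} {e : Bool} (hb : b ≠ spikeBase e) :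
    ¬ (gadgetGraph nxt occ pol K).Adj (base p b) (spike q e) := by
  rintro (h | h) <;> cases h
  contradiction

theorem not_adj_base_base {p q : P} {b b' : Fin 5} (h : ¬ BaseArc b b' ∧ ¬ BaseArc b' b)
    (h04 : ¬ (b = 4 ∧ b' = 0) ∧ ¬ (b = 0 ∧ b' = 4)) :
    ¬ (gadgetGraph nxt occ pol K).Adj (base p b) (base q b') := by
  rintro (h | h) <;> cases h <;> tauto

section Local

variable {S : Set (Sym2 (GadgetVertex P m K))}
  (hE : IsEmpty (SimpleGraph.pathGraph 4 ↪g (gadgetGraph nxt occ pol K).deleteEdges S))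
  (hstack : ∀ p, ∃ j, ∀ v, s(stack p j, v) ∉ S)

include hE

theorem no_gadget_path {a b c d : GadgetVertex P m K} (hab : s(a, b) ∉ S) (hbc : s(b, c) ∉ S)
    (hcd : s(c, d) ∉ S) (gab : (gadgetGraph nxt occ pol K).Adj a b)
    (gbc : (gadgetGraph nxt occ pol K).Adj b c) (gcd : (gadgetGraph nxt occ pol K).Adj c d)
    (hac : ¬ (gadgetGraph nxt occ pol K).Adj a c ∨ s(a, c) ∈ S)
    (hbd : ¬ (gadgetGraph nxt occ pol K).Adj b d ∨ s(b, d) ∈ S)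
    (had : ¬ (gadgetGraph nxt occ pol K).Adj a d ∨ s(a, d) ∈ S) : False := by
  refine no_induced_path_of_isEmpty hE (deleteEdges_adj_of_notMem gab hab)
    (deleteEdges_adj_of_notMem gbc hbc) (deleteEdges_adj_of_notMem gcd hcd) ?_ ?_ ?_ <;>
  · rw [SimpleGraph.deleteEdges_adj]
    tauto

include hstack

theorem exists_mem_basePair (p : P) (k : Fin 4) : ∃ e, basePair p k e ∈ S := by
  by_contra! h
  have h0 := h false
  have h1 := h true
  obtain ⟨j, hj⟩ := hstack p
  obtain ⟨z, hz⟩ := hstack (nxt p)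
  fin_cases k
  · exact no_gadget_path (a := stack p j) (b := base p 0) (c := base p 1) (d := spike p true) hE
      (hj _) h0 h1 (.inl (.stackBase _ _ _ rfl)) (.inl (.inBase _ _ _ (by decide)))
      (.inl (.baseSpike _ _ _ rfl)) (.inl (not_adj_stack_base (by decide) (by decide)))
      (.inl (not_adj_base_spike (by decide))) (.inl not_adj_stack_spike)
  · exact no_gadget_path (a := stack (nxt p) z) (b := base p 4) (c := base p 2) (d := base p 1) hE
      (hz _) (by rwa [Sym2.eq_swap]) (by rwa [Sym2.eq_swap]) (.inr (.baseStack _ _ _ _ rfl rfl))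
      (.inr (.inBase _ _ _ (by decide))) (.inr (.inBase _ _ _ (by decide)))
      (.inl (not_adj_stack_base (by decide) (by decide)))
      (.inl (not_adj_base_base (by decide) (by decide)))
      (.inl (not_adj_stack_base (by decide) (by decide)))
  · exact no_gadget_path (a := stack p j) (b := base p 0) (c := base p 2) (d := base p 3) hE
      (hj _) h0 h1 (.inl (.stackBase _ _ _ rfl)) (.inl (.inBase _ _ _ (by decide)))
      (.inl (.inBase _ _ _ (by decide)))
      (.inl (not_adj_stack_base (by decide) (by decide)))
      (.inl (not_adj_base_base (by decide) (by decide)))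
      (.inl (not_adj_stack_base (by decide) (by decide)))
  · exact no_gadget_path (a := stack (nxt p) z) (b := base p 4) (c := base p 3)
      (d := spike p false) hE
      (hz _) (by rwa [Sym2.eq_swap]) h1 (.inr (.baseStack _ _ _ _ rfl rfl))
      (.inr (.inBase _ _ _ (by decide))) (.inl (.baseSpike _ _ _ rfl))
      (.inl (not_adj_stack_base (by decide) (by decide)))
      (.inl (not_adj_base_spike (by decide))) (.inl not_adj_stack_spike)

/-- If the first base edge survives at the occurrence after `p`, then the last one is deleted at
`p`. -/
theorem mem_basePair_three_of_notMem {p : P} (h : basePair (nxt p) 0 false ∉ S) :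
    basePair p 3 false ∈ S := by
  by_contra h'
  obtain ⟨z, hz⟩ := hstack (nxt p)
  by_cases hs : s(base p 4, base (nxt p) 0) ∈ S
  · exact no_gadget_path (a := base p 3) (b := base p 4) (c := stack (nxt p) z)
      (d := base (nxt p) 0) hE h' (by rw [Sym2.eq_swap]; exact hz _) (hz _)
      (.inl (.inBase _ _ _ (by decide))) (.inl (.baseStack _ _ _ _ rfl rfl))
      (.inl (.stackBase _ _ _ rfl))
      (.inl fun h => not_adj_stack_base (by decide) (by decide) h.symm) (.inr hs)
      (.inl (not_adj_base_base (by decide) (by decide)))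
  · exact no_gadget_path (a := base p 3) (b := base p 4) (c := base (nxt p) 0)
      (d := base (nxt p) 1) hE h' hs h (.inl (.inBase _ _ _ (by decide)))
      (.inl (.shortcut _ _ _ _ rfl rfl rfl)) (.inl (.inBase _ _ _ (by decide)))
      (.inl (not_adj_base_base (by decide) (by decide)))
      (.inl (not_adj_base_base (by decide) (by decide)))
      (.inl (not_adj_base_base (by decide) (by decide)))

/-- When exactly one edge of each pair is deleted at an occurrence that is not its own successor,
the first or the last base edge survives. -/
theorem notMem_basePair_or (hone : ∀ (p : P) k, basePair p k true ∈ S ↔ basePair p k false ∉ S)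
    {p : P} (hp : nxt p ≠ p) : basePair p 0 false ∉ S ∨ basePair p 3 false ∉ S := by
  by_contra! ⟨h0, h3⟩
  have h0' := (hone p 0).not_left.2 h0
  have h3' := (hone p 3).not_left.2 h3
  obtain ⟨j, hj⟩ := hstack p
  have h1 := hone p 1
  have h2 := hone p 2
  have hA : basePair p 1 false ∉ S → basePair p 2 true ∉ S → False := fun h h' =>
    no_gadget_path (a := base p 1) (b := base p 2) (c := base p 3) (d := spike p false) hE
      h h' h3' (.inl (.inBase _ _ _ (by decide))) (.inl (.inBase _ _ _ (by decide)))
      (.inl (.baseSpike _ _ _ rfl))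
      (.inl (not_adj_base_base (by decide) (by decide)))
      (.inl (not_adj_base_spike (by decide))) (.inl (not_adj_base_spike (by decide)))
  have hB : basePair p 1 false ∉ S → basePair p 2 false ∉ S → False := fun h h' =>
    no_gadget_path (a := spike p true) (b := base p 1) (c := base p 2) (d := base p 0) hE
      (by rwa [Sym2.eq_swap]) h (by rwa [Sym2.eq_swap])
      (.inr (.baseSpike _ _ _ rfl)) (.inl (.inBase _ _ _ (by decide)))
      (.inr (.inBase _ _ _ (by decide)))
      (.inl fun h => not_adj_base_spike (by decide) h.symm)
      (.inr (by rwa [Sym2.eq_swap]))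
      (.inl fun h => not_adj_base_spike (by decide) h.symm)
  have hC : basePair p 1 true ∉ S → basePair p 2 true ∉ S → False := fun h h' =>
    no_gadget_path (a := spike p false) (b := base p 3) (c := base p 2) (d := base p 4) hE
      (by rwa [Sym2.eq_swap]) (by rwa [Sym2.eq_swap]) h
      (.inr (.baseSpike _ _ _ rfl)) (.inr (.inBase _ _ _ (by decide)))
      (.inl (.inBase _ _ _ (by decide)))
      (.inl fun h => not_adj_base_spike (by decide) h.symm)
      (.inr h3)
      (.inl fun h => not_adj_base_spike (by decide) h.symm)
  have hD : basePair p 1 true ∉ S → basePair p 2 false ∉ S → False := fun h h' =>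
    no_gadget_path (a := stack p j) (b := base p 0) (c := base p 2) (d := base p 4) hE
      (hj _) h' h (.inl (.stackBase _ _ _ rfl)) (.inl (.inBase _ _ _ (by decide)))
      (.inl (.inBase _ _ _ (by decide)))
      (.inl (not_adj_stack_base (by decide) (by decide)))
      (.inl (by
        rintro (h | h)
        · cases h with
          | shortcut => contradiction
          | inBase _ _ _ h => revert h; decide
        · cases h with
          | shortcut _ _ _ _ _ _ hq => exact hp hq.symm
          | inBase _ _ _ h => revert h; decide))
      (.inl (by
        rintro (h | h) <;> cases h
        · contradiction
        · exact hp (Eq.symm ‹_›)))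
  tauto

/-- The two kinds of spike edges are not both deleted within one variable gadget. -/
theorem not_both_spikes_deleted
    (hone : ∀ (p : P) k, basePair p k true ∈ S ↔ basePair p k false ∉ S)
    (hnxt : Function.Injective nxt) {p q : P} (hpq : ∃ k, nxt^[k] (nxt q) = p)
    (hp : basePair p 0 true ∈ S) (hq : basePair q 3 true ∈ S) : False := by
  obtain ⟨k, rfl⟩ := hpq
  rw [hone] at hp hq
  rw [← Function.iterate_succ_apply, Function.iterate_succ_apply'] at hp
  by_cases hfix : nxt q = q
  · rw [Function.iterate_fixed hfix] at hp
    exact hq (mem_basePair_three_of_notMem hE hstack hp)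
  · have key : ∀ k, nxt (nxt^[k] q) ≠ nxt^[k] q ∧ basePair (nxt^[k] q) 3 false ∉ S := by
      intro k
      induction k with
      | zero => exact ⟨hfix, hq⟩
      | succ k ih =>
        rw [Function.iterate_succ_apply']
        refine ⟨fun h => ih.1 (hnxt h), ?_⟩
        refine (notMem_basePair_or hE hstack hone fun h => ih.1 (hnxt h)).resolve_left fun h => ?_
        exact ih.2 (mem_basePair_three_of_notMem hE hstack h)
    exact (key k).2 (mem_basePair_three_of_notMem hE hstack hp)

omit hstack

/-- Of two distinct literals of a clause, one has no surviving path to the centre, or the other one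
has no surviving edge to the centre. -/
theorem no_wing_paths (hocc : ∀ c a c' a', occ c a = occ c' a' → c = c' ∧ a = a') {c : Fin m}
    {a a' : Fin 3} (hne : a ≠ a') {e e' : Bool} (h : ∀ k, wingPair occ pol c a e k ∉ S)
    (h' : wingPair occ pol c a' e' false ∉ S) : False := by
  refine no_gadget_path (a := spike (occ c a) (pol c a)) (b := wing c a e) (c := centre c)
    (d := wing c a' e') hE (h true) (by rw [Sym2.eq_swap]; exact h false) h'
    (.inl (.link _ _ _ _ _ rfl rfl)) (.inr (.centreWing _ _ _)) (.inl (.centreWing _ _ _))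
    (.inl ?_) (.inl ?_) (.inl ?_)
  · rintro (h | h) <;> cases h
  · rintro (h | h) <;> cases h <;> exact hne rfl
  · have := fun h => hne (hocc c a c a' h).2
    rintro (h | h)
    · generalize occ c a = p at h this
      cases h
      contradiction
    · cases h

theorem spike_deleted {c : Fin m} {a : Fin 3} {e : Bool}
    (h : ∀ k, wingPair occ pol c a e k ∉ S) :
    s(base (occ c a) (spikeBase (pol c a)), spike (occ c a) (pol c a)) ∈ S := by
  by_contra h'
  refine no_gadget_path (a := base (occ c a) (spikeBase (pol c a)))
    (b := spike (occ c a) (pol c a)) (c := wing c a e) (d := centre c) hE h' (h true)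
    (by rw [Sym2.eq_swap]; exact h false) (.inl (.baseSpike _ _ _ rfl))
    (.inl (.link _ _ _ _ _ rfl rfl)) (.inr (.centreWing _ _ _)) (.inl ?_) (.inl ?_) (.inl ?_) <;>
  rintro (h | h) <;> cases h

end Local

theorem sum_ite_mem_le_ncard {ι α : Type*} [Fintype ι] {F : ι → α} (hF : Function.Injective F)
    {S : Set α} (hS : S.Finite) [DecidablePred (· ∈ S)] :
    ∑ i, (if F i ∈ S then 1 else 0) ≤ S.ncard := by
  classical
  rw [← Finset.card_filter, ← Finset.card_image_of_injective _ hF, ← Set.ncard_coe_finset]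
  refine Set.ncard_le_ncard ?_ hS
  intro x
  simp only [Finset.coe_image, Finset.coe_filter, Finset.mem_univ, true_and, Set.mem_image,
    Set.mem_ofPred_eq]
  rintro ⟨i, hi, rfl⟩
  exact hi

/-- A small deletion set meets every base pair in exactly one edge, and leaves a path from the
centre of every clause gadget to one of its spikes. -/
theorem tight_of_isEmpty [Finite P] (hcard : Nat.card P = 3 * m)
    (hocc : ∀ c a c' a', occ c a = occ c' a' → c = c' ∧ a = a')
    {S : Set (Sym2 (GadgetVertex P m K))} (hk : S.ncard ≤ 16 * m)
    (hE : IsEmpty (SimpleGraph.pathGraph 4 ↪g (gadgetGraph nxt occ pol K).deleteEdges S))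
    (hstack : ∀ p, ∃ j, ∀ v, s(stack p j, v) ∉ S) :
    (∀ (p : P) k, basePair p k true ∈ S ↔ basePair p k false ∉ S) ∧
      ∀ c, ∃ a e, ∀ k, wingPair occ pol c a e k ∉ S := by
  classical
  have := Fintype.ofFinite P
  let δ : Sym2 (GadgetVertex P m K) → ℕ := fun x => if x ∈ S then 1 else 0
  have hδ : ∀ {x}, x ∈ S → δ x = 1 := fun h => if_pos h
  let B : P → ℕ := fun p => ∑ k, ∑ e, δ (basePair p k e)
  let W : Fin m → ℕ := fun c => ∑ a, ∑ e, ∑ k, δ (wingPair occ pol c a e k)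
  have hpair : ∀ (p : P) k, 1 ≤ ∑ e, δ (basePair p k e) := by
    intro p k
    obtain ⟨e, he⟩ := exists_mem_basePair hE hstack p k
    exact (hδ he).ge.trans (Finset.single_le_sum (f := fun e => δ (basePair p k e))
      (fun _ _ => Nat.zero_le _) (Finset.mem_univ e))
  have hB : ∀ p ∈ Finset.univ, 4 ≤ B p := fun p _ =>
    (by simp : 4 = ∑ _k : Fin 4, 1).le.trans (Finset.sum_le_sum fun k _ => hpair p k)
  have hW' : ∀ c, (∃ a e, ∀ k, wingPair occ pol c a e k ∉ S) ∧ 4 ≤ W c ∨ 6 ≤ W c := by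
    intro c
    by_cases h : ∃ a e, ∀ k, wingPair occ pol c a e k ∉ S
    · refine .inl ⟨h, ?_⟩
      obtain ⟨a, e, h⟩ := h
      have hf : ∀ a', a' ≠ a → ∀ e', 1 ≤ ∑ k, δ (wingPair occ pol c a' e' k) := by
        intro a' hne e'
        have : wingPair occ pol c a' e' false ∈ S := by
          by_contra h'
          exact no_wing_paths hE hocc hne.symm h h'
        simp [hδ this]
      have h1 : ∑ a' : Fin 3, ∑ _e : Bool, (if a' = a then 0 else 1) ≤ W c := by
        refine Finset.sum_le_sum fun a' _ => Finset.sum_le_sum fun e' _ => ?_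
        split_ifs with hne
        · exact Nat.zero_le _
        · exact hf a' hne e'
      refine le_trans ?_ h1
      clear * - a
      revert a
      decide
    · right
      push Not at h
      have h1 : ∑ _a : Fin 3, ∑ _e : Bool, 1 ≤ W c := by
        refine Finset.sum_le_sum fun a _ => Finset.sum_le_sum fun e _ => ?_
        obtain ⟨k, hk⟩ := h a e
        exact (hδ hk).ge.trans (Finset.single_le_sum (f := fun k => δ (wingPair occ pol c a e k))
          (fun _ _ => Nat.zero_le _) (Finset.mem_univ k))
      simpa using h1
  have hW : ∀ c ∈ Finset.univ, 4 ≤ W c := fun c _ => by have := hW' c; omega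
  have htotal : ∑ p, B p + ∑ c, W c ≤ 16 * m := by
    refine le_trans ?_ hk
    refine le_trans ?_ (sum_ite_mem_le_ncard (injective_basePair_wingPair occ pol) S.toFinite)
    simp only [Fintype.sum_sum_type, Fintype.sum_prod_type, Sum.elim_inl, Sum.elim_inr]
    exact le_rfl
  have hB4 : ∑ _p : P, 4 = 12 * m := by
    rw [Finset.sum_const, Finset.card_univ, ← Nat.card_eq_fintype_card, hcard, smul_eq_mul]
    ring
  have hW4 : ∑ _c : Fin m, 4 = 4 * m := by simp [mul_comm]
  have hB' := Finset.sum_le_sum hB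
  have hW'' := Finset.sum_le_sum hW
  have hBeq := (Finset.sum_eq_sum_iff_of_le hB).1 (by omega)
  have hWeq := (Finset.sum_eq_sum_iff_of_le hW).1 (by omega)
  constructor
  · intro p k
    have h1 : ∑ _k : Fin 4, 1 = B p := by simpa using hBeq p (Finset.mem_univ p)
    have := (Finset.sum_eq_sum_iff_of_le fun k _ => hpair p k).1 h1 k (Finset.mem_univ k)
    rw [Fintype.sum_bool] at this
    by_cases ht : basePair p k true ∈ S <;> by_cases hf : basePair p k false ∈ S <;>
      simp [ht, hf, δ] at this ⊢
  · intro c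
    rcases hW' c with h | h
    · exact h.1
    · have := hWeq c (Finset.mem_univ c)
      omega

/-- A small deletion set marks every clause by a deleted spike edge, consistently along each orbit
of `nxt`. -/
theorem exists_spike_deleted [Finite P] (hcard : Nat.card P = 3 * m)
    (hnxt : Function.Injective nxt)
    (hocc : ∀ c a c' a', occ c a = occ c' a' → c = c' ∧ a = a') (hK : 16 * m < K)
    {S : Set (Sym2 (GadgetVertex P m K))} (hS : S ⊆ (gadgetGraph nxt occ pol K).edgeSet)
    (hk : S.ncard ≤ 16 * m)
    (hE : IsEmpty (SimpleGraph.pathGraph 4 ↪g (gadgetGraph nxt occ pol K).deleteEdges S)) :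
    ∃ cut : P → Bool → Prop, (∀ c, ∃ a, cut (occ c a) (pol c a)) ∧
      ∀ p q, (∃ k, nxt^[k] (nxt q) = p) → cut p true → ¬ cut q false := by
  have hstack := exists_stack_notMem hS (hk.trans_lt hK)
  obtain ⟨hone, hwing⟩ := tight_of_isEmpty hcard hocc hk hE hstack
  refine ⟨fun p e => s(base p (spikeBase e), spike p e) ∈ S, fun c => ?_, fun p q h hp hq =>
    not_both_spikes_deleted hE hstack hone hnxt h hp hq⟩
  obtain ⟨a, e, h⟩ := hwing c
  exact ⟨a, spike_deleted hE h⟩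

end Gadget

section Formula

variable {m : ℕ} (lit : Fin m → Fin 3 → Var × Bool)

theorem occIdx_lt_occIdx {c c' : Fin m} {a : Fin 3} (h : c < c') :
    occIdx lit (lit c a).1 c < occIdx lit (lit c a).1 c' := by
  refine Finset.card_lt_card (Finset.ssubset_iff_of_subset ?_ |>.2 ⟨c, ?_, ?_⟩)
  · intro d hd
    simp only [Finset.mem_filter] at hd ⊢
    exact ⟨hd.1, hd.2.1.trans h, hd.2.2⟩
  · simp only [Finset.mem_filter, Finset.mem_univ, true_and]
    exact ⟨h, a, rfl⟩
  · simp

theorem occIdx_lt_numOcc (c : Fin m) (a : Fin 3) :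
    occIdx lit (lit c a).1 c < numOcc lit (lit c a).1 := by
  refine Finset.card_lt_card (Finset.ssubset_iff_of_subset ?_ |>.2 ⟨c, ?_, ?_⟩)
  · intro d hd
    simp only [Finset.mem_filter] at hd ⊢
    exact ⟨hd.1, hd.2.2⟩
  · simp
  · simp

/-- The occurrences of the variables of a formula. -/
abbrev Occurrence : Type := Σ x : Var, Fin (numOcc lit x)

variable {lit}

theorem Occurrence.mk_eq_mk_iff {x y : Var} {i : Fin (numOcc lit x)} {j : Fin (numOcc lit y)} :
    (⟨x, i⟩ : Occurrence lit) = ⟨y, j⟩ ↔ x = y ∧ (i : ℕ) = j := by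
  constructor
  · rintro h
    cases h
    exact ⟨rfl, rfl⟩
  · rintro ⟨rfl, h⟩
    rw [Fin.ext h]

/-- The cyclically next occurrence of the same variable. -/
def nextOcc (p : Occurrence lit) : Occurrence lit :=
  ⟨p.1, (p.2 + 1) % numOcc lit p.1, Nat.mod_lt _ (Nat.zero_lt_of_lt p.2.2)⟩

variable (lit) in
/-- The occurrence at a given position of a clause. -/
def occAt (c : Fin m) (a : Fin 3) : Occurrence lit :=
  ⟨(lit c a).1, occIdx lit (lit c a).1 c, occIdx_lt_numOcc lit c a⟩

theorem nextOcc_iterate (k : ℕ) (p : Occurrence lit) : nextOcc^[k] p =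
    ⟨p.1, (p.2 + k) % numOcc lit p.1, Nat.mod_lt _ (Nat.zero_lt_of_lt p.2.2)⟩ := by
  induction k with
  | zero => simp [Nat.mod_eq_of_lt]
  | succ k ih =>
    rw [Function.iterate_succ_apply', ih, nextOcc, Occurrence.mk_eq_mk_iff]
    simp [add_assoc]

theorem exists_nextOcc_iterate_eq {p q : Occurrence lit} (h : p.1 = q.1) :
    ∃ k, nextOcc^[k] q = p := by
  obtain ⟨x, i⟩ := p
  obtain ⟨y, j⟩ := q
  obtain rfl : x = y := h
  refine ⟨i + (numOcc lit x - j), ?_⟩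
  have : (j : ℕ) + (i + (numOcc lit x - j)) = i + numOcc lit x := by omega
  simp only [nextOcc_iterate, this]
  simp [Nat.mod_eq_of_lt]

theorem nextOcc_injective : Function.Injective (nextOcc (lit := lit)) := by
  intro p q h
  obtain ⟨x, i⟩ := p
  obtain ⟨y, j⟩ := q
  rw [nextOcc, nextOcc, Occurrence.mk_eq_mk_iff] at h
  obtain ⟨rfl, h⟩ := h
  rw [Occurrence.mk_eq_mk_iff]
  exact ⟨rfl, Nat.ModEq.eq_of_lt_of_lt (Nat.ModEq.add_right_cancel' 1 h) i.2 j.2⟩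

theorem occAt_injective (hdist : ∀ c, Function.Injective (fun a : Fin 3 => (lit c a).1))
    (c : Fin m) (a : Fin 3) (c' : Fin m) (a' : Fin 3) (h : occAt lit c a = occAt lit c' a') :
    c = c' ∧ a = a' := by
  obtain ⟨hx, hi⟩ := Occurrence.mk_eq_mk_iff.1 h
  obtain rfl : c = c' := by
    rcases lt_trichotomy c c' with h | h | h
    · have := occIdx_lt_occIdx lit (a := a) h
      simp only [hx] at this hi
      omega
    · exact h
    · have := occIdx_lt_occIdx lit (a := a') h
      simp only [hx] at this hi
      omega
  exact ⟨rfl, hdist c hx⟩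

theorem exists_occAt_eq (p : Occurrence lit) : ∃ c a, occAt lit c a = p := by
  obtain ⟨x, i⟩ := p
  let T := {c : Fin m // ∃ a, (lit c a).1 = x}
  have hlt : ∀ c : T, occIdx lit x c < numOcc lit x := by
    rintro ⟨c, a, rfl⟩
    exact occIdx_lt_numOcc lit c a
  have hinj : Function.Injective fun c : T => (⟨occIdx lit x c, hlt c⟩ : Fin (numOcc lit x)) := by
    have key : ∀ c c' : T, c.1 < c'.1 → occIdx lit x c < occIdx lit x c' := by
      rintro ⟨c, a, rfl⟩ c' h
      exact occIdx_lt_occIdx lit h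
    intro c c' h
    have h := Fin.mk.inj h
    rcases lt_trichotomy c.1 c'.1 with h' | h' | h'
    · exact absurd h (key _ _ h').ne
    · exact Subtype.ext h'
    · exact absurd h (key _ _ h').ne'
  have hcard : Fintype.card T = Fintype.card (Fin (numOcc lit x)) := by
    rw [Fintype.card_fin, Fintype.card_subtype, numOcc]
  obtain ⟨⟨c, a, rfl⟩, h⟩ := ((Fintype.bijective_iff_injective_and_card _).2 ⟨hinj, hcard⟩).2 i
  exact ⟨c, a, Occurrence.mk_eq_mk_iff.2 ⟨rfl, Fin.val_eq_of_eq h⟩⟩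

theorem occAt_bijective (hdist : ∀ c, Function.Injective (fun a : Fin 3 => (lit c a).1)) :
    Function.Bijective (fun x : Fin m × Fin 3 => occAt lit x.1 x.2) := by
  refine ⟨fun x y h => ?_, fun p => ?_⟩
  · exact Prod.ext_iff.2 (occAt_injective hdist _ _ _ _ h)
  · obtain ⟨c, a, h⟩ := exists_occAt_eq p
    exact ⟨(c, a), h⟩

theorem card_occurrence (hdist : ∀ c, Function.Injective (fun a : Fin 3 => (lit c a).1)) :
    Nat.card (Occurrence lit) = 3 * m := by
  rw [← Nat.card_congr (Equiv.ofBijective _ (occAt_bijective hdist))]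
  simp [mul_comm]

variable (lit) in
/-- The vertices of `satP4DelGraph` as gadget vertices. -/
def gadgetVertexEquiv :
    ((Σ x : Var, Fin (numOcc lit x) × (Fin (16 * m + 3) ⊕ Fin 2 ⊕ Fin 5)) ⊕
      (Fin m × (Unit ⊕ Fin 3 × Fin 2))) ≃ GadgetVertex (Occurrence lit) m (16 * m + 3) where
  toFun
    | .inl ⟨x, i, .inl j⟩ => .stack ⟨x, i⟩ j
    | .inl ⟨x, i, .inr (.inl e)⟩ => .spike ⟨x, i⟩ (e = 0)
    | .inl ⟨x, i, .inr (.inr b)⟩ => .base ⟨x, i⟩ b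
    | .inr (c, .inl _) => .centre c
    | .inr (c, .inr (a, e)) => .wing c a (e = 1)
  invFun
    | .stack p j => .inl ⟨p.1, p.2, .inl j⟩
    | .spike p e => .inl ⟨p.1, p.2, .inr (.inl (if e then 0 else 1))⟩
    | .base p b => .inl ⟨p.1, p.2, .inr (.inr b)⟩
    | .centre c => .inr (c, .inl ())
    | .wing c a e => .inr (c, .inr (a, if e then 1 else 0))
  left_inv := by
    rintro (⟨x, i, j | e | b⟩ | ⟨c, _ | ⟨a, e⟩⟩)
    · rfl
    · fin_cases e <;> rfl
    · rfl
    · rfl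
    · fin_cases e <;> rfl
  right_inv := by
    rintro (_ | ⟨_, e⟩ | _ | _ | ⟨_, _, e⟩)
    · rfl
    · cases e <;> rfl
    · rfl
    · rfl
    · cases e <;> rfl

theorem fromRel_adj_iff_of_iff {V W : Type*} {R : V → V → Prop} {R' : W → W → Prop}
    {G : SimpleGraph W} (hG : ∀ v w, G.Adj v w ↔ R' v w ∨ R' w v) (f : V ≃ W)
    (h : ∀ v w, R' (f v) (f w) ↔ R v w) (v w : V) :
    G.Adj (f v) (f w) ↔ (SimpleGraph.fromRel R).Adj v w := by
  rw [SimpleGraph.fromRel_adj, ← h, ← h, ← hG]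
  exact ⟨fun h => ⟨fun e => h.ne (congrArg f e), h⟩, fun h => h.2⟩

theorem baseArc_iff {b b' : Fin 5} : BaseArc b b' ↔
    ((b : ℕ), (b' : ℕ)) ∈ ({(0, 1), (0, 2), (1, 2), (2, 3), (2, 4), (3, 4)} : Set (ℕ × ℕ)) := by
  revert b b'
  simp only [BaseArc, Set.mem_insert_iff, Set.mem_singleton_iff, Prod.mk.injEq]
  decide

variable (lit) in
/-- `satP4DelGraph` is a gadget graph. -/
def satP4DelGraphIso : satP4DelGraph lit ≃g
    gadgetGraph nextOcc (occAt lit) (fun c a => (lit c a).2) (16 * m + 3) where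
  toEquiv := gadgetVertexEquiv lit
  map_rel_iff' {v w} := by
    refine fromRel_adj_iff_of_iff (fun _ _ => Iff.rfl) (gadgetVertexEquiv lit) ?_ v w
    rintro (⟨x, i, j | e | b⟩ | ⟨c, _ | ⟨a, e⟩⟩) (⟨y, i', j' | e' | b'⟩ | ⟨c', _ | ⟨a', e'⟩⟩)
    all_goals dsimp only [gadgetVertexEquiv, Equiv.coe_fn_mk]
    case inl.inl.inl.inr.inr =>
      constructor
      · intro h
        cases h
        simp_all
      · rintro ⟨rfl, ⟨h, h'⟩ | ⟨h, h'⟩⟩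
        · rw [Fin.ext h]
          exact .stackBase _ _ _ (Fin.ext h')
        · exact h'.elim
    case inl.inr.inr.inl.inl =>
      constructor
      · intro h
        cases h with
        | baseStack _ _ _ _ hb hq =>
          obtain ⟨rfl, h⟩ := Occurrence.mk_eq_mk_iff.1 hq
          exact ⟨rfl, .inr ⟨h, by rw [hb]; rfl⟩⟩
      · rintro ⟨rfl, ⟨h, h'⟩ | ⟨h, h'⟩⟩
        · exact h'.elim
        · exact .baseStack _ _ _ _ (Fin.ext h') (Occurrence.mk_eq_mk_iff.2 ⟨rfl, h⟩)
    case inl.inr.inr.inl.inr.inl =>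
      constructor
      · intro h
        cases h with
        | baseSpike _ _ _ hb =>
          refine ⟨rfl, .inl ⟨rfl, ?_⟩⟩
          revert b e'
          decide
      · rintro ⟨rfl, ⟨h, h'⟩ | ⟨h, h'⟩⟩
        · rw [Fin.ext h]
          refine .baseSpike _ _ _ ?_
          clear * - h'
          revert b e'
          decide
        · exact h'.elim
    case inl.inr.inr.inl.inr.inr =>
      constructor
      · intro h
        cases h with
        | inBase _ _ _ h => exact ⟨rfl, .inl ⟨rfl, baseArc_iff.1 h⟩⟩
        | shortcut _ _ _ _ hb hb' hq =>
          obtain ⟨rfl, h⟩ := Occurrence.mk_eq_mk_iff.1 hq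
          exact ⟨rfl, .inr ⟨h, by rw [hb]; rfl, by rw [hb']; rfl⟩⟩
      · rintro ⟨rfl, ⟨h, h'⟩ | ⟨h, h'⟩⟩
        · rw [Fin.ext h]
          exact .inBase _ _ _ (baseArc_iff.2 h')
        · exact .shortcut _ _ _ _ (Fin.ext h'.1) (Fin.ext h'.2)
            (Occurrence.mk_eq_mk_iff.2 ⟨rfl, h⟩)
    case inl.inr.inl.inr.inr =>
      constructor
      · intro h
        cases h with
        | link _ _ _ _ _ hp hf =>
          obtain ⟨rfl, h⟩ := Occurrence.mk_eq_mk_iff.1 hp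
          refine ⟨_, rfl, h, ?_⟩
          rw [← hf]
          congr 2
          clear * -
          revert e
          decide
      · rintro ⟨b, hb, h, h'⟩
        obtain rfl : (lit c' a').1 = x := by rw [hb]
        refine .link _ _ _ _ _ (Occurrence.mk_eq_mk_iff.2 ⟨rfl, h⟩) ?_
        rw [hb]
        replace h' := Sum.inl.inj (Sum.inr.inj h')
        subst h'
        cases b <;> rfl
    case inr.inl.inr.inr =>
      constructor
      · intro h
        cases h
        simp
      · rintro ⟨rfl, _⟩
        exact .centreWing _ _ _
    case inr.inr.inr.inr =>
      constructor
      · intro h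
        cases h with
        | wingWing _ _ _ _ he he' =>
          refine ⟨rfl, rfl, ?_⟩
          clear * - he he'
          revert e e'
          decide
      · rintro ⟨rfl, rfl, h⟩
        refine .wingWing _ _ _ _ ?_ ?_ <;>
        · clear * - h
          revert e e'
          decide
    all_goals
      constructor
      · intro h
        cases h
      · intro h
        simp at h

end Formula

/-- The 3-SAT formula `φ` (clauses with exactly three literals on pairwise distinct
variables) is satisfiable iff at most `k_φ = 16|C(φ)|` edges can be deleted from `G_φ` so
that no induced `P₄` remains. -/
theorem satP4DelGraph_correct {m : ℕ} (lit : Fin m → Fin 3 → Var × Bool)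
    (hdist : ∀ c, Function.Injective (fun a : Fin 3 => (lit c a).1)) :
    (∃ α : Var → Bool, ∀ c : Fin m, ∃ a : Fin 3, α (lit c a).1 = (lit c a).2) ↔
    (∃ S ⊆ (satP4DelGraph lit).edgeSet, S.ncard ≤ 16 * m ∧
      IsEmpty (SimpleGraph.pathGraph 4 ↪g ((satP4DelGraph lit).deleteEdges S))) := by
  refine ⟨fun ⟨α, hα⟩ => ?_, fun h => ?_⟩
  · choose sel hsel using hα
    have hfin : Finite (Occurrence lit) := Finite.of_surjective _ (occAt_bijective hdist).2
    exact exists_deleteEdges_of_iso (satP4DelGraphIso lit).symm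
      (exists_deletion_of_assignment (β := fun p => α p.1) (card_occurrence hdist)
        nextOcc_injective (occAt_injective hdist) (fun _ => rfl) hsel)
  · have hfin : Finite (Occurrence lit) := Finite.of_surjective _ (occAt_bijective hdist).2
    obtain ⟨S, hS, hk, hE⟩ := exists_deleteEdges_of_iso (satP4DelGraphIso lit) h
    obtain ⟨cut, hcut, hcons⟩ := exists_spike_deleted (card_occurrence hdist) nextOcc_injective
      (occAt_injective hdist) (by omega) hS hk hE
    classical
    refine ⟨fun x => decide (∃ p : Occurrence lit, p.1 = x ∧ cut p true), fun c => ?_⟩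
    obtain ⟨a, ha⟩ := hcut c
    refine ⟨a, ?_⟩
    cases hpol : (lit c a).2 <;> rw [hpol] at ha
    · refine decide_eq_false ?_
      rintro ⟨p, hp, hp'⟩
      exact hcons p _ (exists_nextOcc_iterate_eq (q := nextOcc (occAt lit c a)) hp) hp' ha
    · exact decide_eq_true ⟨_, rfl, ha⟩
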